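/- arXiv:1312.5017 — 2 statements merged into one kernel-verified Lean document; each statement's English description precedes it below -/
import Mathlib

section
/- Let p ∈ ℝ^n, and let a_1, a_2, a_3, a_4 ∈ ℝ^n be collinear points with a_1 ≠ a_4, lying on a line not passing through p, with a_2 ≠ a_1 and a_3 ≠ a_4. Let b_1, b_2, b_3, b_4 ∈ ℝ^n be collinear points with b_1 ≠ b_4, b_2 ≠ b_1, b_3 ≠ b_4, lying on a line not passing through p, such that for each i the point b_i lies on the ray emanating from p through a_i. Then [a_1,a_2,a_3,a_4] = [b_1,b_2,b_3,b_4], where [x_1,x_2,x_3,x_4] = (‖x_3−x_1‖·‖x_2−x_4‖)/(‖x_3−x_4‖·‖x_2−x_1‖) and ‖·‖ is the Euclidean norm. -/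
/-!
STATEMENT 3: Cross ratios are preserved under projection from a point p: if a₁,a₂,a₃,a₄ are
collinear (a₁ ≠ a₄, a₂ ≠ a₁, a₃ ≠ a₄, the line not through p), b₁,b₂,b₃,b₄ are collinear
(b₁ ≠ b₄, b₂ ≠ b₁, b₃ ≠ b₄, the line not through p), and each bᵢ lies on the ray from p
through aᵢ, then [a₁,a₂,a₃,a₄] = [b₁,b₂,b₃,b₄], where
[x₁,x₂,x₃,x₄] = (‖x₃−x₁‖·‖x₂−x₄‖)/(‖x₃−x₄‖·‖x₂−x₁‖).
-/

noncomputable def crossRatio4 {E : Type*} [NormedAddCommGroup E] (x₁ x₂ x₃ x₄ : E) : ℝ :=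
  (‖x₃ - x₁‖ * ‖x₂ - x₄‖) / (‖x₃ - x₄‖ * ‖x₂ - x₁‖)

open scoped RealInnerProductSpace

/-- The Gram determinant of the pairs `(x, y)` and `(u, v)`. -/
noncomputable def gramPair {E : Type*} [NormedAddCommGroup E] [InnerProductSpace ℝ E]
    (u v x y : E) : ℝ :=
  ⟪x, u⟫ * ⟪y, v⟫ - ⟪y, u⟫ * ⟪x, v⟫

theorem gramPair_add_smul {E : Type*} [NormedAddCommGroup E] [InnerProductSpace ℝ E]
    (u v x y : E) (α β : ℝ) :
    gramPair u v (x + α • y) (x + β • y) = (β - α) * gramPair u v x y := by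
  simp only [gramPair, inner_add_left, real_inner_smul_left]
  ring

theorem gramPair_smul_smul {E : Type*} [NormedAddCommGroup E] [InnerProductSpace ℝ E]
    (u v x y : E) (s t : ℝ) :
    gramPair u v (s • x) (t • y) = s * t * gramPair u v x y := by
  simp only [gramPair, real_inner_smul_left]
  ring

theorem exists_eq_smul_of_gramPair_self_eq_zero {E : Type*} [NormedAddCommGroup E]
    [InnerProductSpace ℝ E] {u v : E} (hv : v ≠ 0) (h : gramPair u v u v = 0) :
    ∃ s : ℝ, u = s • v := by
  have hvv : ⟪v, v⟫ ≠ 0 := inner_self_ne_zero.mpr hv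
  refine ⟨⟪u, v⟫ / ⟪v, v⟫, sub_eq_zero.mp (inner_self_eq_zero (𝕜 := ℝ).mp ?_)⟩
  simp only [gramPair] at h
  simp only [inner_sub_left, inner_sub_right, real_inner_smul_left, real_inner_smul_right]
  rw [real_inner_comm u v] at *
  field_simp
  linarith

/-- A central projection from `p` between two lines avoiding `p` scales the distance between the
images of two points by a constant times the product of the scaling factors at these points. -/
theorem exists_norm_sub_eq_of_central_projection {ι E : Type*} [NormedAddCommGroup E]
    [InnerProductSpace ℝ E] {p : E} {a b : ι → E} {t : ι → ℝ}
    (hacol : Collinear ℝ (Set.range a)) (hap : ¬ Collinear ℝ (insert p (Set.range a)))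
    (hbcol : Collinear ℝ (Set.range b)) {k l : ι} (ha : a k ≠ a l) (hb : b k ≠ b l)
    (ht : ∀ i, t i ≠ 0) (hab : ∀ i, b i = p + t i • (a i - p)) :
    ∃ c : ℝ, c ≠ 0 ∧ ∀ i j, ‖b i - b j‖ = c * (|t i| * |t j| * ‖a i - a j‖) := by
  obtain ⟨q, v, hq⟩ := (collinear_iff_exists_forall_eq_smul_vadd _).mp hacol
  obtain ⟨r, w, hr⟩ := (collinear_iff_exists_forall_eq_smul_vadd _).mp hbcol
  choose α hα using fun i => hq (a i) ⟨i, rfl⟩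
  choose β hβ using fun i => hr (b i) ⟨i, rfl⟩
  simp only [vadd_eq_add] at hα hβ
  have hαsub (i j : ι) : a i - a j = (α i - α j) • v := by rw [hα i, hα j]; module
  have hβsub (i j : ι) : b i - b j = (β i - β j) • w := by rw [hβ i, hβ j]; module
  have hv : v ≠ 0 := by
    rintro rfl
    exact ha (sub_eq_zero.mp (by rw [hαsub, smul_zero]))
  have hw : w ≠ 0 := by
    rintro rfl
    exact hb (sub_eq_zero.mp (by rw [hβsub, smul_zero]))
  have hαkl : α l - α k ≠ 0 := by
    intro h
    exact ha (sub_eq_zero.mp (by rw [hαsub, ← neg_sub, h, neg_zero, zero_smul]))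
  have hG : gramPair (q - p) v (q - p) v ≠ 0 := by
    intro h
    obtain ⟨s, hs⟩ := exists_eq_smul_of_gramPair_self_eq_zero hv h
    refine hap ((collinear_iff_exists_forall_eq_smul_vadd _).mpr ⟨q, v, ?_⟩)
    rintro x (rfl | hx)
    · exact ⟨-s, by rw [neg_smul, ← hs, vadd_eq_add]; abel⟩
    · exact hq x hx
  set G := gramPair (q - p) v (q - p) v
  set C := gramPair (q - p) v (r - p) w
  have key (i j : ι) : t i * t j * ((α j - α i) * G) = (β j - β i) * C := by
    have hbi (i : ι) : (r - p) + β i • w = t i • ((q - p) + α i • v) := by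
      calc (r - p) + β i • w = b i - p := by rw [hβ i]; abel
        _ = t i • (a i - p) := by rw [hab i]; abel
        _ = t i • ((q - p) + α i • v) := by rw [hα i]; congr 1; abel
    rw [← gramPair_add_smul, ← gramPair_add_smul, hbi, hbi, gramPair_smul_smul]
  have hC : C ≠ 0 := by
    intro h
    have := key k l
    rw [h, mul_zero] at this
    exact mul_ne_zero (mul_ne_zero (ht k) (ht l)) (mul_ne_zero hαkl hG) this
  have hv' := norm_ne_zero_iff.mpr hv
  have hw' := norm_ne_zero_iff.mpr hw
  have hC' := abs_ne_zero.mpr hC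
  refine ⟨|G| * ‖w‖ / (|C| * ‖v‖), by positivity, fun i j => ?_⟩
  have h := congrArg abs (key j i)
  simp only [abs_mul] at h
  rw [hαsub, hβsub, norm_smul, norm_smul, Real.norm_eq_abs, Real.norm_eq_abs]
  field_simp
  linarith

theorem crossRatio_projection_invariance
    (n : ℕ) (p : EuclideanSpace ℝ (Fin n)) (a b : Fin 4 → EuclideanSpace ℝ (Fin n))
    (hacol : Collinear ℝ (Set.range a))
    (ha14 : a 0 ≠ a 3) (ha21 : a 1 ≠ a 0) (ha34 : a 2 ≠ a 3)
    (hap : ¬ Collinear ℝ (insert p (Set.range a)))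
    (hbcol : Collinear ℝ (Set.range b))
    (hb14 : b 0 ≠ b 3) (hb21 : b 1 ≠ b 0) (hb34 : b 2 ≠ b 3)
    (hbp : ¬ Collinear ℝ (insert p (Set.range b)))
    (hray : ∀ i : Fin 4, ∃ t : ℝ, 0 ≤ t ∧ b i = p + t • (a i - p)) :
    crossRatio4 (a 0) (a 1) (a 2) (a 3) = crossRatio4 (b 0) (b 1) (b 2) (b 3) := by
  choose t _ hab using hray
  have ht (i : Fin 4) : t i ≠ 0 := by
    intro h
    have hbi : b i = p := by rw [hab i, h, zero_smul, add_zero]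
    exact hbp (by rwa [Set.insert_eq_of_mem (Set.mem_range.mpr ⟨i, hbi⟩)])
  obtain ⟨c, hc, hdist⟩ :=
    exists_norm_sub_eq_of_central_projection hacol hap hbcol ha14 hb14 ht hab
  have ht' (i : Fin 4) : |t i| ≠ 0 := abs_ne_zero.mpr (ht i)
  have h0 := ht' 0
  have h1 := ht' 1
  have h2 := ht' 2
  have h3 := ht' 3
  simp only [crossRatio4, hdist]
  field_simp
end

section
/- Let W be a Coxeter group of rank n with generating set S whose associated bilinear form B has signature (n-1,1). Then there exists a W-equivariant continuous surjection F : ∂_G W → Λ(W) from the Gromov boundary of W (with respect to the word metric for S) onto the limit set Λ(W) of the normalized action of W. -/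
/-!
STATEMENT 17: Main theorem.  Let W be a Coxeter group of rank n with generating set S whose
associated bilinear form B has signature (n-1,1).  Then there exists a W-equivariant
continuous surjection F : ∂_G W → Λ(W) from the Gromov boundary of W (for the word metric
of S, in the sense of Buckley–Kokkendorff) onto the limit set of the normalized action of W.
-/

open Matrix Filter Set

noncomputable section

/-- The bilinear form associated to the matrix `B`. -/
def bform {ι : Type*} [Fintype ι] (B : Matrix ι ι ℝ) (u v : ι → ℝ) : ℝ :=
  u ⬝ᵥ B.mulVec v

/-- `|v|₁ = ∑ i, oᵢ vᵢ`. -/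
def l1 {ι : Type*} [Fintype ι] (o v : ι → ℝ) : ℝ := ∑ i, o i * v i

/-- The normalization `v̂ = v / |v|₁`. -/
def nrm {ι : Type*} [Fintype ι] (o v : ι → ℝ) : ι → ℝ := (l1 o v)⁻¹ • v

/-- The Gromov product `(x|y)` on `W`, based at the identity, with respect to the word
metric for the Coxeter generating set `S`. -/
def gp {B : Type*} {M : CoxeterMatrix B} {W : Type*} [Group W]
    (cs : CoxeterSystem M W) (x y : W) : ℝ :=
  ((cs.length x : ℝ) + (cs.length y : ℝ) - (cs.length (x⁻¹ * y) : ℝ)) / 2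

/-- A Gromov sequence: `(x_i | x_j) → ∞` as `i, j → ∞`. -/
def IsGromovSeq {B : Type*} {M : CoxeterMatrix B} {W : Type*} [Group W]
    (cs : CoxeterSystem M W) (x : ℕ → W) : Prop :=
  Tendsto (fun p : ℕ × ℕ => gp cs (x p.1) (x p.2)) atTop atTop

/-- The set of Gromov sequences of `(W, S)`. -/
def GromovSeq {B : Type*} {M : CoxeterMatrix B} {W : Type*} [Group W]
    (cs : CoxeterSystem M W) := {x : ℕ → W // IsGromovSeq cs x}

/-- The relation `x ∼_G y`: `liminf_{i,j → ∞} (x_i | y_j) = ∞`. -/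
def gromovRel {B : Type*} {M : CoxeterMatrix B} {W : Type*} [Group W]
    (cs : CoxeterSystem M W) (x y : GromovSeq cs) : Prop :=
  Tendsto (fun p : ℕ × ℕ => gp cs (x.1 p.1) (y.1 p.2)) atTop atTop

/-- The Gromov boundary of `(W, S)`: equivalence classes of Gromov sequences under the
transitive closure of `∼_G` (the equivalence relation generated by `∼_G`). -/
def GBdry {B : Type*} {M : CoxeterMatrix B} {W : Type*} [Group W]
    (cs : CoxeterSystem M W) := Quot (gromovRel cs)

/-- The Gromov product extended to boundary points:
`(a|b) = inf {liminf (x_i|y_j) : [x] = a, [y] = b}` for `a ≠ b` and `(a|a) = ∞`. -/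
def egp {B : Type*} {M : CoxeterMatrix B} {W : Type*} [Group W]
    (cs : CoxeterSystem M W) (a b : GBdry cs) : ENNReal :=
  letI := Classical.dec (a = b)
  if a = b then ⊤ else
    ⨅ (x : GromovSeq cs) (_ : Quot.mk (gromovRel cs) x = a)
      (y : GromovSeq cs) (_ : Quot.mk (gromovRel cs) y = b),
      Filter.liminf (fun p : ℕ × ℕ => ENNReal.ofReal (gp cs (x.1 p.1) (y.1 p.2))) atTop

/-- The topology on the Gromov boundary, generated by the subbasis
`U(a,r) = {b : (a|b) > r}`. -/
def bdryTop {B : Type*} {M : CoxeterMatrix B} {W : Type*} [Group W]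
    (cs : CoxeterSystem M W) : TopologicalSpace (GBdry cs) :=
  TopologicalSpace.generateFrom
    {U | ∃ (a : GBdry cs) (r : ℝ), 0 < r ∧ U = {b | ENNReal.ofReal r < egp cs a b}}

/-- The limit set `Λ(W)`: the set of accumulation points of the orbit `W·o` of the
normalized action. -/
def limitSet {n : ℕ} (o : Fin n → ℝ) {W : Type*} [Group W]
    (ρ : W →* Module.End ℝ (Fin n → ℝ)) : Set (Fin n → ℝ) :=
  {x | ∃ f : ℕ → W, Function.Injective f ∧
    Tendsto (fun j => nrm o (ρ (f j) o)) atTop (nhds x)}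

section BilinearForm

variable {ι : Type*} [Fintype ι] (B : Matrix ι ι ℝ)

lemma bform_add_right (u v w : ι → ℝ) : bform B u (v + w) = bform B u v + bform B u w := by
  simp [bform, mulVec_add, dotProduct_add]

lemma bform_sub_left (u v w : ι → ℝ) : bform B (u - v) w = bform B u w - bform B v w := by
  simp [bform, sub_dotProduct]

lemma bform_sub_right (u v w : ι → ℝ) : bform B u (v - w) = bform B u v - bform B u w := by
  simp [bform, mulVec_sub, dotProduct_sub]

lemma bform_smul_left (c : ℝ) (u v : ι → ℝ) : bform B (c • u) v = c * bform B u v := by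
  simp [bform, smul_dotProduct]

lemma bform_smul_right (c : ℝ) (u v : ι → ℝ) : bform B u (c • v) = c * bform B u v := by
  simp [bform, mulVec_smul, dotProduct_smul]

variable {B} in
lemma bform_comm (hB : B.IsSymm) (u v : ι → ℝ) : bform B u v = bform B v u := by
  rw [bform, bform, dotProduct_mulVec, ← mulVec_transpose, hB.eq, dotProduct_comm]

lemma bform_single_single [DecidableEq ι] (i j : ι) :
    bform B (Pi.single i 1) (Pi.single j 1) = B i j := by
  simp [bform]

lemma bform_eq_sum (u v : ι → ℝ) : bform B u v = ∑ i, ∑ j, u i * (B i j * v j) := by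
  simp [bform, dotProduct, mulVec, Finset.mul_sum]

lemma continuous_bform_self : Continuous fun v : ι → ℝ => bform B v v := by
  simp only [bform_eq_sum]
  fun_prop

variable (o : ι → ℝ)

lemma l1_add (u v : ι → ℝ) : l1 o (u + v) = l1 o u + l1 o v := by
  simp [l1, mul_add, Finset.sum_add_distrib]

lemma l1_sub (u v : ι → ℝ) : l1 o (u - v) = l1 o u - l1 o v := by
  simp [l1, mul_sub, Finset.sum_sub_distrib]

lemma l1_smul (c : ℝ) (v : ι → ℝ) : l1 o (c • v) = c * l1 o v := by
  simp only [l1, Pi.smul_apply, smul_eq_mul, Finset.mul_sum]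
  exact Finset.sum_congr rfl fun i _ => by ring

lemma l1_zero : l1 o 0 = 0 := by simp [l1]

lemma continuous_l1 : Continuous (l1 o) := by
  unfold l1
  fun_prop

lemma l1_nrm {v : ι → ℝ} (hv : l1 o v ≠ 0) : l1 o (nrm o v) = 1 := by
  rw [nrm, l1_smul, inv_mul_cancel₀ hv]

lemma nrm_smul {c : ℝ} (hc : c ≠ 0) (v : ι → ℝ) : nrm o (c • v) = nrm o v := by
  rw [nrm, nrm, l1_smul, smul_smul, mul_inv, mul_assoc, mul_comm _ c, ← mul_assoc,
    inv_mul_cancel₀ hc, one_mul]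

lemma continuousAt_nrm {v : ι → ℝ} (hv : l1 o v ≠ 0) : ContinuousAt (nrm o) v :=
  ((continuous_l1 o).continuousAt.inv₀ hv).smul continuousAt_id

end BilinearForm

/-- A representation of a Coxeter system by reflections in the simple roots, for a symmetric
form which is negative on an eigenvector `o` with positive coordinates and positive definite
on the orthogonal complement of `o`. -/
structure IsLorentzianRep {n : ℕ} (B : Matrix (Fin n) (Fin n) ℝ) {M : CoxeterMatrix (Fin n)}
    (o : Fin n → ℝ) (lam : ℝ) {W : Type*} [Group W] (cs : CoxeterSystem M W)
    (ρ : W →* Module.End ℝ (Fin n → ℝ)) : Prop where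
  isSymm : B.IsSymm
  diag : ∀ i, B i i = 1
  of_ne_zero : ∀ i j, M i j ≠ 0 → B i j = -Real.cos (Real.pi / (M i j : ℝ))
  of_eq_zero : ∀ i j, M i j = 0 → B i j ≤ -1
  lam_neg : lam < 0
  eigen : B.mulVec o = lam • o
  pos : ∀ i, 0 < o i
  sum_sq : ∑ i, (o i) ^ 2 = 1
  simple_apply : ∀ (i : Fin n) (v : Fin n → ℝ),
    ρ (cs.simple i) v = v - (2 * bform B (Pi.single i 1) v) • (Pi.single i 1 : Fin n → ℝ)
  coercive : ∃ μ : ℝ, 0 < μ ∧ ∀ v, l1 o v = 0 → μ * (v ⬝ᵥ v) ≤ bform B v v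

/-- The coefficients of the roots of a dihedral group: `altCoeff (cos θ) m = sin (m θ) / sin θ`. -/
def altCoeff (c : ℝ) : ℕ → ℝ
  | 0 => 0
  | 1 => 1
  | m + 2 => 2 * c * altCoeff c (m + 1) - altCoeff c m

lemma altCoeff_cos_mul_sin (θ : ℝ) (m : ℕ) :
    altCoeff (Real.cos θ) m * Real.sin θ = Real.sin (m * θ) := by
  induction m using Nat.twoStepInduction with
  | zero => simp [altCoeff]
  | one => simp [altCoeff]
  | more m h0 h1 =>
    have e0 : Real.sin (m * θ) = Real.sin ((m + 1 : ℕ) * θ - θ) := by push_cast; ring_nf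
    have e2 : Real.sin ((m + 2 : ℕ) * θ) = Real.sin ((m + 1 : ℕ) * θ + θ) := by
      push_cast; ring_nf
    rw [e0, Real.sin_sub] at h0
    rw [e2, Real.sin_add, altCoeff, sub_mul, h0, mul_assoc, h1]
    ring

lemma altCoeff_nonneg_of_one_le {c : ℝ} (hc : 1 ≤ c) (m : ℕ) : 0 ≤ altCoeff c m := by
  have key : ∀ m, 0 ≤ altCoeff c m ∧ altCoeff c m ≤ altCoeff c (m + 1) := by
    intro m
    induction m with
    | zero => simp [altCoeff]
    | succ m ih =>
      refine ⟨ih.1.trans ih.2, ?_⟩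
      rw [altCoeff]
      nlinarith
  exact (key m).1

namespace IsLorentzianRep

variable {n : ℕ} {B : Matrix (Fin n) (Fin n) ℝ} {M : CoxeterMatrix (Fin n)}
  {o : Fin n → ℝ} {lam : ℝ} {W : Type*} [Group W] {cs : CoxeterSystem M W}
  {ρ : W →* Module.End ℝ (Fin n → ℝ)}

lemma bform_rho (H : IsLorentzianRep B o lam cs ρ) (w : W) (u v : Fin n → ℝ) :
    bform B (ρ w u) (ρ w v) = bform B u v := by
  induction w using cs.simple_induction_left generalizing u v with
  | one => simp
  | mul_simple_left w i ih =>
    rw [map_mul, Module.End.mul_apply, Module.End.mul_apply, ← ih u v]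
    generalize ρ w u = u
    generalize ρ w v = v
    simp only [H.simple_apply, bform_sub_left, bform_sub_right, bform_smul_left,
      bform_smul_right, bform_single_single, H.diag, bform_comm H.isSymm u (Pi.single i 1)]
    ring

lemma bform_o_right (H : IsLorentzianRep B o lam cs ρ) (v : Fin n → ℝ) :
    bform B v o = lam * l1 o v := by
  rw [bform, H.eigen, dotProduct_smul, smul_eq_mul, dotProduct_comm]
  rfl

lemma bform_single_o (H : IsLorentzianRep B o lam cs ρ) (i : Fin n) :
    bform B (Pi.single i 1) o = lam * o i := by
  rw [H.bform_o_right, l1]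
  simp [Pi.single_apply]

lemma altCoeff_nonneg (H : IsLorentzianRep B o lam cs ρ) {i j : Fin n} (hij : i ≠ j) {m : ℕ}
    (hm : M i j ≠ 0 → m ≤ M i j) : 0 ≤ altCoeff (-B i j) m := by
  by_cases h0 : M i j = 0
  · exact altCoeff_nonneg_of_one_le (by linarith [H.of_eq_zero i j h0]) m
  · have hne1 : M i j ≠ 1 := M.off_diagonal i j hij
    have h2 : (2 : ℝ) ≤ M i j := by
      have : 2 ≤ M i j := by omega
      exact_mod_cast this
    have hMm : (m : ℝ) ≤ M i j := by exact_mod_cast hm h0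
    rw [H.of_ne_zero i j h0, neg_neg]
    have hpi := Real.pi_pos
    have hsin : 0 < Real.sin (Real.pi / M i j) :=
      Real.sin_pos_of_pos_of_lt_pi (by positivity) (by rw [div_lt_iff₀ (by linarith)]; nlinarith)
    refine nonneg_of_mul_nonneg_left ?_ hsin
    rw [altCoeff_cos_mul_sin]
    refine Real.sin_nonneg_of_nonneg_of_le_pi (by positivity) ?_
    rw [mul_div_assoc', div_le_iff₀ (by linarith)]
    nlinarith

lemma rho_alternatingWord (H : IsLorentzianRep B o lam cs ρ) (i j : Fin n) (m : ℕ) :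
    ρ (cs.wordProd (CoxeterSystem.alternatingWord i j m)) (Pi.single i 1) =
      altCoeff (-B i j) (m + 1) • (Pi.single (if Even m then i else j) 1 : Fin n → ℝ) +
      altCoeff (-B i j) m • (Pi.single (if Even m then j else i) 1 : Fin n → ℝ) := by
  induction m with
  | zero => simp [CoxeterSystem.alternatingWord, altCoeff]
  | succ m ih =>
    rw [CoxeterSystem.alternatingWord_succ', cs.wordProd_cons, map_mul, Module.End.mul_apply, ih,
      H.simple_apply, altCoeff]
    have hs : B j i = B i j := H.isSymm.apply i j
    by_cases hm : Even m
    · simp only [hm, Nat.even_add_one, not_true, if_true, if_false, bform_add_right,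
        bform_smul_right, bform_single_single, H.diag, hs]
      module
    · simp only [hm, Nat.even_add_one, not_false_eq_true, if_true, if_false, bform_add_right,
        bform_smul_right, bform_single_single, H.diag]
      module

end IsLorentzianRep

/-- An element without right descent at `i` factors, with lengths adding up, as an element
without right descents in `{i, j}` times an alternating word in `i, j`. -/
lemma CoxeterSystem.exists_eq_mul_alternatingWord {I : Type*} {M : CoxeterMatrix I} {W : Type*}
    [Group W] (cs : CoxeterSystem M W) (w : W) (i j : I) (hi : ¬ cs.IsRightDescent w i) :
    ∃ (v : W) (m : ℕ), w = v * cs.wordProd (CoxeterSystem.alternatingWord i j m) ∧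
      cs.length w = cs.length v + m ∧ ¬ cs.IsRightDescent v i ∧ ¬ cs.IsRightDescent v j := by
  induction hk : cs.length w generalizing w i j with
  | zero =>
    obtain rfl := cs.length_eq_zero_iff.mp hk
    exact ⟨1, 0, by simp [CoxeterSystem.alternatingWord], by simp, cs.not_isRightDescent_one i,
      cs.not_isRightDescent_one j⟩
  | succ k ih =>
    by_cases hj : cs.IsRightDescent w j
    · have hlen := cs.isRightDescent_iff.mp hj
      obtain ⟨v, m, hv, hl, hvj, hvi⟩ := ih (w * cs.simple j) j i
        (cs.isRightDescent_iff_not_isRightDescent_mul.mp hj) (by omega)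
      refine ⟨v, m + 1, ?_, by omega, hvi, hvj⟩
      rw [CoxeterSystem.alternatingWord_succ, cs.wordProd_concat, ← mul_assoc, ← hv]
      simp
    · exact ⟨w, 0, by simp [CoxeterSystem.alternatingWord], by omega, hi, hj⟩

namespace IsLorentzianRep

variable {n : ℕ} {B : Matrix (Fin n) (Fin n) ℝ} {M : CoxeterMatrix (Fin n)}
  {o : Fin n → ℝ} {lam : ℝ} {W : Type*} [Group W] {cs : CoxeterSystem M W}
  {ρ : W →* Module.End ℝ (Fin n → ℝ)}

/-- If `i` is not a right descent of `w`, then `w` maps the simple root `i` to a positive root. -/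
lemma rho_single_nonneg (H : IsLorentzianRep B o lam cs ρ) (w : W) (i : Fin n)
    (hi : ¬ cs.IsRightDescent w i) (k : Fin n) : 0 ≤ ρ w (Pi.single i 1) k := by
  induction hl : cs.length w using Nat.strong_induction_on generalizing w i with
  | _ l ih =>
    by_cases hw : w = 1
    · subst hw
      simp only [map_one, Module.End.one_apply, Pi.single_apply]
      split_ifs <;> norm_num
    obtain ⟨j, hj⟩ := cs.exists_rightDescent_of_ne_one hw
    have hij : i ≠ j := by rintro rfl; exact hi hj
    obtain ⟨v, m, hv, hlen, hvi, hvj⟩ := cs.exists_eq_mul_alternatingWord w i j hi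
    have hm : 0 < m := by
      rcases Nat.eq_zero_or_pos m with rfl | hm
      · simp only [CoxeterSystem.alternatingWord, cs.wordProd_nil, mul_one] at hv
        exact absurd (hv ▸ hj) hvj
      · exact hm
    have hmM : M i j ≠ 0 → m + 1 ≤ M i j := by
      intro h0
      by_contra hcon
      refine cs.not_isReduced_alternatingWord j i (m := m + 1) (M.symmetric i j ▸ h0)
        (by rw [M.symmetric j i]; omega) ?_
      have h1 := cs.not_isRightDescent_iff.mp hi
      have h2 := cs.length_mul_le v
        (cs.wordProd (CoxeterSystem.alternatingWord j i (m + 1)))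
      have h3 := cs.length_wordProd_le (CoxeterSystem.alternatingWord j i (m + 1))
      rw [CoxeterSystem.length_alternatingWord] at h3
      have h4 : w * cs.simple i =
          v * cs.wordProd (CoxeterSystem.alternatingWord j i (m + 1)) := by
        rw [CoxeterSystem.alternatingWord_succ, cs.wordProd_concat, ← mul_assoc, ← hv]
      rw [CoxeterSystem.IsReduced, CoxeterSystem.length_alternatingWord]
      rw [← h4] at h2
      omega
    have ha := H.altCoeff_nonneg hij hmM
    have hb := H.altCoeff_nonneg hij (m := m) (fun h => by have := hmM h; omega)
    have hxi := ih (cs.length v) (by omega) v i hvi rfl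
    have hxj := ih (cs.length v) (by omega) v j hvj rfl
    rw [hv, map_mul, Module.End.mul_apply, H.rho_alternatingWord, map_add, map_smul, map_smul]
    simp only [Pi.add_apply, Pi.smul_apply, smul_eq_mul]
    split_ifs <;> positivity

end IsLorentzianRep

/-- The height `|w(o)|₁` of the orbit point `w(o)`. -/
def orbitHeight {n : ℕ} (o : Fin n → ℝ) {W : Type*} [Group W]
    (ρ : W →* Module.End ℝ (Fin n → ℝ)) (w : W) : ℝ := l1 o (ρ w o)

namespace IsLorentzianRep

variable {n : ℕ} {B : Matrix (Fin n) (Fin n) ℝ} {M : CoxeterMatrix (Fin n)}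
  {o : Fin n → ℝ} {lam : ℝ} {W : Type*} [Group W] {cs : CoxeterSystem M W}
  {ρ : W →* Module.End ℝ (Fin n → ℝ)}

lemma bform_orbit (H : IsLorentzianRep B o lam cs ρ) (u v : W) :
    bform B (ρ u o) (ρ v o) = lam * orbitHeight o ρ (v⁻¹ * u) := by
  rw [← H.bform_rho v⁻¹, ← Module.End.mul_apply, ← Module.End.mul_apply, ← map_mul, ← map_mul,
    inv_mul_cancel, map_one, Module.End.one_apply, H.bform_o_right, orbitHeight]

lemma rho_mul_simple_o (H : IsLorentzianRep B o lam cs ρ) (w : W) (i : Fin n) :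
    ρ (w * cs.simple i) o = ρ w o + (2 * -lam * o i) • ρ w (Pi.single i 1) := by
  rw [map_mul, Module.End.mul_apply, H.simple_apply, H.bform_single_o, map_sub, map_smul]
  module

lemma orbitHeight_mul_simple (H : IsLorentzianRep B o lam cs ρ) (w : W) (i : Fin n) :
    orbitHeight o ρ (w * cs.simple i) =
      orbitHeight o ρ w + 2 * -lam * o i * l1 o (ρ w (Pi.single i 1)) := by
  rw [orbitHeight, H.rho_mul_simple_o, l1_add, l1_smul, orbitHeight]

lemma orbitHeight_one (H : IsLorentzianRep B o lam cs ρ) : orbitHeight o ρ 1 = 1 := by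
  rw [orbitHeight, map_one, Module.End.one_apply, l1, ← H.sum_sq]
  exact Finset.sum_congr rfl fun i _ => (pow_two _).symm

lemma orbitHeight_reflection (H : IsLorentzianRep B o lam cs ρ) (w : W) (i : Fin n) :
    orbitHeight o ρ (w * cs.simple i * w⁻¹) =
      1 + 2 * -lam * l1 o (ρ w (Pi.single i 1)) ^ 2 := by
  have h1 : ρ w (ρ w⁻¹ o) = o := by
    rw [← Module.End.mul_apply, ← map_mul, mul_inv_cancel, map_one, Module.End.one_apply]
  have h2 : ρ (w * cs.simple i * w⁻¹) o =
      o - (2 * (lam * l1 o (ρ w (Pi.single i 1)))) • ρ w (Pi.single i 1) := by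
    rw [map_mul, Module.End.mul_apply, map_mul, Module.End.mul_apply, H.simple_apply, map_sub,
      map_smul, h1, ← H.bform_rho w, h1, H.bform_o_right]
  have h3 : l1 o o = 1 := by
    rw [← H.orbitHeight_one, orbitHeight, map_one, Module.End.one_apply]
  rw [orbitHeight, h2, l1_sub, l1_smul, h3]
  ring

lemma l1_nonneg (H : IsLorentzianRep B o lam cs ρ) {v : Fin n → ℝ} (hv : ∀ k, 0 ≤ v k) :
    0 ≤ l1 o v :=
  Finset.sum_nonneg fun i _ => mul_nonneg (H.pos i).le (hv i)

lemma exists_pos_le (H : IsLorentzianRep B o lam cs ρ) : ∃ m : ℝ, 0 < m ∧ ∀ i, m ≤ o i := by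
  rcases isEmpty_or_nonempty (Fin n) with h | h
  · exact ⟨1, one_pos, fun i => h.elim i⟩
  · obtain ⟨i, hi⟩ := Finite.exists_min o
    exact ⟨o i, H.pos i, hi⟩

lemma exists_le_mul_l1 (H : IsLorentzianRep B o lam cs ρ) :
    ∃ C : ℝ, 0 < C ∧ ∀ v : Fin n → ℝ, (∀ k, 0 ≤ v k) → ∀ k, v k ≤ C * l1 o v := by
  obtain ⟨m, hm, hmo⟩ := H.exists_pos_le
  refine ⟨m⁻¹, inv_pos.mpr hm, fun v hv k => ?_⟩
  rw [← div_eq_inv_mul, le_div_iff₀ hm, mul_comm]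
  calc m * v k ≤ o k * v k := mul_le_mul_of_nonneg_right (hmo k) (hv k)
    _ ≤ l1 o v := Finset.single_le_sum (f := fun i => o i * v i)
        (fun i _ => mul_nonneg (H.pos i).le (hv i)) (Finset.mem_univ k)

lemma exists_bform_le (B : Matrix (Fin n) (Fin n) ℝ) : ∃ C : ℝ, 0 < C ∧
    ∀ (v : Fin n → ℝ) (r : ℝ), (∀ k, |v k| ≤ r) → bform B v v ≤ C * r ^ 2 := by
  refine ⟨1 + ∑ i, ∑ j, |B i j|, by positivity, fun v r hr => ?_⟩
  rw [bform_eq_sum, add_mul, Finset.sum_mul]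
  refine le_add_of_nonneg_of_le (by positivity) (Finset.sum_le_sum fun i _ => ?_)
  rw [Finset.sum_mul]
  refine Finset.sum_le_sum fun j _ => ?_
  calc v i * (B i j * v j) ≤ |v i * (B i j * v j)| := le_abs_self _
    _ = |B i j| * (|v i| * |v j|) := by rw [abs_mul, abs_mul]; ring
    _ ≤ |B i j| * (r * r) := by
      gcongr
      · exact (abs_nonneg _).trans (hr i)
      · exact hr i
      · exact hr j
    _ = |B i j| * r ^ 2 := by ring

/-- Heights of positive roots are bounded below. -/
lemma exists_le_l1_root (H : IsLorentzianRep B o lam cs ρ) : ∃ δ : ℝ, 0 < δ ∧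
    ∀ (w : W) (i : Fin n), ¬ cs.IsRightDescent w i → δ ≤ l1 o (ρ w (Pi.single i 1)) := by
  obtain ⟨C, hC, hCv⟩ := H.exists_le_mul_l1
  obtain ⟨D, hD, hDv⟩ := exists_bform_le B
  refine ⟨√(1 / (D * C ^ 2)), by positivity, fun w i hi => ?_⟩
  have hnn := H.rho_single_nonneg w i hi
  refine Real.sqrt_le_iff.mpr ⟨H.l1_nonneg hnn, ?_⟩
  have h1 := hDv (ρ w (Pi.single i 1)) (C * l1 o (ρ w (Pi.single i 1)))
    (fun k => by rw [abs_of_nonneg (hnn k)]; exact hCv _ hnn k)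
  rw [H.bform_rho, bform_single_single, H.diag] at h1
  rw [div_le_iff₀ (by positivity)]
  linarith

lemma rho_o_nonneg (H : IsLorentzianRep B o lam cs ρ) (w : W) (k : Fin n) : 0 ≤ ρ w o k := by
  induction hl : cs.length w generalizing w with
  | zero =>
    obtain rfl := cs.length_eq_zero_iff.mp hl
    simpa using (H.pos k).le
  | succ l ih =>
    have hw : w ≠ 1 := by rintro rfl; simp at hl
    obtain ⟨i, hi⟩ := cs.exists_rightDescent_of_ne_one hw
    have hlen := cs.isRightDescent_iff.mp hi
    have h1 := H.rho_mul_simple_o (w * cs.simple i) i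
    rw [cs.simple_mul_simple_cancel_right] at h1
    have h2 := H.rho_single_nonneg _ i (cs.isRightDescent_iff_not_isRightDescent_mul.mp hi) k
    have h3 := ih (w * cs.simple i) (by omega)
    have h4 := H.pos i
    have h5 : 0 < -lam := neg_pos.mpr H.lam_neg
    rw [h1, Pi.add_apply, Pi.smul_apply, smul_eq_mul]
    positivity

lemma exists_add_length_le_orbitHeight (H : IsLorentzianRep B o lam cs ρ) : ∃ δ : ℝ, 0 < δ ∧
    ∀ w : W, 1 + δ * cs.length w ≤ orbitHeight o ρ w := by
  obtain ⟨δ, hδ, hroot⟩ := H.exists_le_l1_root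
  obtain ⟨m, hm, hmo⟩ := H.exists_pos_le
  have h5 : 0 < -lam := neg_pos.mpr H.lam_neg
  refine ⟨2 * -lam * m * δ, by positivity, fun w => ?_⟩
  induction hl : cs.length w generalizing w with
  | zero =>
    obtain rfl := cs.length_eq_zero_iff.mp hl
    simp [H.orbitHeight_one]
  | succ l ih =>
    have hw : w ≠ 1 := by rintro rfl; simp at hl
    obtain ⟨i, hi⟩ := cs.exists_rightDescent_of_ne_one hw
    have hlen := cs.isRightDescent_iff.mp hi
    have h1 := H.orbitHeight_mul_simple (w * cs.simple i) i
    rw [cs.simple_mul_simple_cancel_right] at h1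
    have h2 := hroot _ i (cs.isRightDescent_iff_not_isRightDescent_mul.mp hi)
    have h3 := ih (w * cs.simple i) (by omega)
    have h6 : 2 * -lam * m * δ ≤ 2 * -lam * o i * l1 o (ρ (w * cs.simple i) (Pi.single i 1)) := by
      have h7 := hmo i
      have h8 := H.pos i
      gcongr
    rw [h1]
    push_cast
    linarith

lemma one_le_orbitHeight (H : IsLorentzianRep B o lam cs ρ) (w : W) : 1 ≤ orbitHeight o ρ w := by
  obtain ⟨δ, hδ, h⟩ := H.exists_add_length_le_orbitHeight
  have : 0 ≤ δ * cs.length w := by positivity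
  linarith [h w]

lemma exists_add_le_orbitHeight (H : IsLorentzianRep B o lam cs ρ) : ∃ δ : ℝ, 0 < δ ∧
    ∀ w : W, w ≠ 1 → 1 + δ ≤ orbitHeight o ρ w := by
  obtain ⟨δ, hδ, h⟩ := H.exists_add_length_le_orbitHeight
  refine ⟨δ, hδ, fun w hw => ?_⟩
  have h1 : (1 : ℝ) ≤ cs.length w := by
    exact_mod_cast Nat.one_le_iff_ne_zero.mpr (mt cs.length_eq_zero_iff.mp hw)
  nlinarith [h w]

/-- The orbit of `o` is uniformly separated for the sup norm. -/
lemma exists_orbit_separated (H : IsLorentzianRep B o lam cs ρ) : ∃ r : ℝ, 0 < r ∧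
    ∀ u v : W, (∀ k, |ρ u o k - ρ v o k| ≤ r) → u = v := by
  obtain ⟨δ, hδ, h⟩ := H.exists_add_le_orbitHeight
  obtain ⟨D, hD, hDv⟩ := exists_bform_le B
  have h5 : 0 < -lam := neg_pos.mpr H.lam_neg
  refine ⟨√(-lam * δ / D), by positivity, fun u v huv => ?_⟩
  by_contra hne
  have h1 := hDv (ρ u o - ρ v o) _ huv
  rw [Real.sq_sqrt (by positivity), mul_div_cancel₀ _ hD.ne'] at h1
  simp only [bform_sub_left, bform_sub_right, H.bform_orbit, inv_mul_cancel,
    H.orbitHeight_one] at h1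
  have h2 := h (v⁻¹ * u) (fun h => hne (inv_mul_eq_one.mp h).symm)
  have h3 := h (u⁻¹ * v) (fun h => hne (inv_mul_eq_one.mp h))
  nlinarith

/-- Polynomial bound on the number of orbit points of bounded height. -/
lemma exists_card_le (H : IsLorentzianRep B o lam cs ρ) : ∃ K : ℝ, 0 < K ∧
    ∀ (T : Finset W) (L : ℝ), 0 ≤ L → (∀ w ∈ T, orbitHeight o ρ w ≤ L) →
      (T.card : ℝ) ≤ (K * L) ^ n := by
  obtain ⟨C, hC, hCv⟩ := H.exists_le_mul_l1
  obtain ⟨r, hr, hsep⟩ := H.exists_orbit_separated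
  refine ⟨C / r + 1, by positivity, fun T L hL hT => ?_⟩
  rcases T.eq_empty_or_nonempty with rfl | ⟨w₀, hw₀⟩
  · simp only [Finset.card_empty, Nat.cast_zero]
    positivity
  have hL1 : 1 ≤ L := (H.one_le_orbitHeight w₀).trans (hT w₀ hw₀)
  have hcard : T.card ≤
      (Fintype.piFinset fun _ : Fin n => Finset.range (⌊C / r * L⌋₊ + 1)).card := by
    refine Finset.card_le_card_of_injOn (fun w k => ⌊ρ w o k / r⌋₊) (fun w hw => ?_) ?_
    · simp only [Fintype.coe_piFinset, Set.mem_pi, Finset.coe_range, Set.mem_Iio, Set.mem_univ,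
        forall_const, Nat.lt_succ_iff]
      intro k
      refine Nat.floor_le_floor ?_
      rw [div_mul_eq_mul_div]
      gcongr
      exact (hCv _ (H.rho_o_nonneg w) k).trans (by gcongr; exact hT w hw)
    · intro u _ v _ huv
      refine hsep u v fun k => ?_
      have hk : ⌊ρ u o k / r⌋₊ = ⌊ρ v o k / r⌋₊ := congrFun huv k
      have hu := div_nonneg (H.rho_o_nonneg u k) hr.le
      have hv := div_nonneg (H.rho_o_nonneg v k) hr.le
      have a1 := Nat.floor_le hu
      have a2 := Nat.lt_floor_add_one (ρ u o k / r)
      have b1 := Nat.floor_le hv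
      have b2 := Nat.lt_floor_add_one (ρ v o k / r)
      rw [hk] at a1 a2
      have : |ρ u o k / r - ρ v o k / r| ≤ 1 := abs_le.mpr ⟨by linarith, by linarith⟩
      rwa [← sub_div, abs_div, abs_of_pos hr, div_le_one hr] at this
  rw [Fintype.card_piFinset_const, Finset.card_range] at hcard
  calc (T.card : ℝ) ≤ ((⌊C / r * L⌋₊ : ℝ) + 1) ^ n := by exact_mod_cast hcard
    _ ≤ ((C / r + 1) * L) ^ n := by
      gcongr
      have := Nat.floor_le (show 0 ≤ C / r * L by positivity)
      linarith

lemma exists_sum_leftInvSeq_le (H : IsLorentzianRep B o lam cs ρ) : ∃ c : ℝ, 0 < c ∧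
    ∀ ω : List (Fin n), cs.IsReduced ω →
      c * ((cs.leftInvSeq ω).map fun t => √(orbitHeight o ρ t - 1)).sum ≤
        orbitHeight o ρ (cs.wordProd ω) := by
  obtain ⟨m, hm, hmo⟩ := H.exists_pos_le
  have h5 : 0 < -lam := neg_pos.mpr H.lam_neg
  refine ⟨m * √(2 * -lam), by positivity, fun ω => ?_⟩
  induction ω using List.reverseRecOn with
  | nil =>
    intro _
    simp [H.orbitHeight_one]
  | append_singleton ω i ih =>
    intro hω
    have hred : cs.IsReduced ω := by simpa using hω.take ω.length
    have hdesc : ¬ cs.IsRightDescent (cs.wordProd ω) i := by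
      rw [cs.not_isRightDescent_iff, ← cs.wordProd_concat, List.concat_eq_append, hω.eq, hred.eq]
      simp
    have hb := H.l1_nonneg (H.rho_single_nonneg _ i hdesc)
    rw [← List.concat_eq_append, cs.leftInvSeq_concat, cs.wordProd_concat,
      H.orbitHeight_mul_simple, List.concat_eq_append, List.map_append, List.sum_append,
      List.map_singleton, List.sum_singleton, H.orbitHeight_reflection, mul_add]
    refine add_le_add (ih hred) ?_
    rw [add_sub_cancel_left, Real.sqrt_mul (x := 2 * -lam) (by positivity), Real.sqrt_sq hb]
    calc m * √(2 * -lam) * (√(2 * -lam) * l1 o (ρ (cs.wordProd ω) (Pi.single i 1)))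
        = (√(2 * -lam) * √(2 * -lam)) * m * l1 o (ρ (cs.wordProd ω) (Pi.single i 1)) := by ring
      _ = 2 * -lam * m * l1 o (ρ (cs.wordProd ω) (Pi.single i 1)) := by
        rw [Real.mul_self_sqrt (by positivity)]
      _ ≤ _ := by
        have := hmo i
        gcongr

/-- Superlinear growth of the height in terms of the word length. -/
lemma exists_rpow_le_orbitHeight (H : IsLorentzianRep B o lam cs ρ) (hn : 0 < n) :
    ∃ c p : ℝ, 0 < c ∧ 1 < p ∧ ∀ w : W, c * (cs.length w : ℝ) ^ p ≤ orbitHeight o ρ w := by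
  obtain ⟨c, hc, hsum⟩ := H.exists_sum_leftInvSeq_le
  obtain ⟨K, hK, hcard⟩ := H.exists_card_le
  obtain ⟨δ, hδ, hgap⟩ := H.exists_add_le_orbitHeight
  have hn' : (0 : ℝ) < n := by exact_mod_cast hn
  set q : ℝ := 1 / (2 * n) with hq
  have hq0 : 0 < q := by positivity
  set e : ℝ := √(δ / (1 + δ)) with he
  have he0 : 0 < e := by positivity
  refine ⟨c * (e / √K) * (1 / 2) ^ (1 + q), 1 + q, by positivity, by linarith, fun w => ?_⟩
  obtain ⟨ω, hω, rfl⟩ := cs.exists_isReduced w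
  classical
  set T := (cs.leftInvSeq ω).toFinset with hT
  have hTcard : T.card = cs.length (cs.wordProd ω) := by
    rw [hT, List.toFinset_card_of_nodup hω.nodup_leftInvSeq, cs.length_leftInvSeq, hω.eq]
  set k : ℝ := (cs.length (cs.wordProd ω) : ℝ) with hk
  have hk0 : 0 ≤ k := by positivity
  have hTsum : ((cs.leftInvSeq ω).map fun t => √(orbitHeight o ρ t - 1)).sum =
      ∑ t ∈ T, √(orbitHeight o ρ t - 1) := by
    rw [hT, List.sum_toFinset _ hω.nodup_leftInvSeq]
  refine le_trans ?_ (hsum ω hω)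
  rw [hTsum, mul_assoc, mul_assoc]
  refine mul_le_mul_of_nonneg_left ?_ hc.le
  set L : ℝ := (k / 2) ^ (1 / (n : ℝ)) / K with hL
  have hL0 : 0 ≤ L := by positivity
  have hsmall : ((T.filter fun t => orbitHeight o ρ t ≤ L).card : ℝ) ≤ k / 2 := by
    refine (hcard _ L hL0 fun t ht => (Finset.mem_filter.mp ht).2).trans_eq ?_
    rw [hL, mul_div_cancel₀ _ hK.ne', ← Real.rpow_natCast, ← Real.rpow_mul (by positivity),
      one_div_mul_cancel hn'.ne', Real.rpow_one]
  have hlarge : k / 2 ≤ ((T.filter fun t => ¬ orbitHeight o ρ t ≤ L).card : ℝ) := by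
    have h1 := T.card_filter_add_card_filter_not fun t => orbitHeight o ρ t ≤ L
    have h2 : ((T.filter fun t => orbitHeight o ρ t ≤ L).card : ℝ) +
        (T.filter fun t => ¬ orbitHeight o ρ t ≤ L).card = k := by
      rw [hk, ← hTcard, ← h1]
      push_cast
      rfl
    linarith
  have hterm : ∀ t ∈ T, ¬ orbitHeight o ρ t ≤ L → e * √L ≤ √(orbitHeight o ρ t - 1) := by
    intro t ht htL
    have ht1 : t ≠ 1 := by
      rintro rfl
      have := (cs.isReflection_of_mem_leftInvSeq ω (List.mem_toFinset.mp ht)).odd_length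
      simp at this
    have hg := hgap t ht1
    rw [he, ← Real.sqrt_mul (by positivity)]
    refine Real.sqrt_le_sqrt ?_
    rw [div_mul_eq_mul_div, div_le_iff₀ (by positivity)]
    nlinarith
  have hsqrtL : √L = (k / 2) ^ q / √K := by
    rw [hL, Real.sqrt_div (by positivity), Real.sqrt_eq_rpow, ← Real.rpow_mul (by positivity), hq]
    congr 2
    field_simp
  calc e / √K * ((1 / 2) ^ (1 + q) * k ^ (1 + q)) = k / 2 * (e * √L) := by
        rw [← Real.mul_rpow (by norm_num) hk0, one_div_mul_eq_div, hsqrtL,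
          Real.rpow_add_of_nonneg (by positivity) zero_le_one hq0.le, Real.rpow_one]
        ring
    _ ≤ ((T.filter fun t => ¬ orbitHeight o ρ t ≤ L).card : ℝ) * (e * √L) := by gcongr
    _ ≤ ∑ t ∈ T.filter fun t => ¬ orbitHeight o ρ t ≤ L, √(orbitHeight o ρ t - 1) := by
        rw [← nsmul_eq_mul]
        refine Finset.card_nsmul_le_sum _ _ _ fun t ht => ?_
        exact hterm t (Finset.mem_filter.mp ht).1 (Finset.mem_filter.mp ht).2
    _ ≤ ∑ t ∈ T, √(orbitHeight o ρ t - 1) :=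
        Finset.sum_le_sum_of_subset_of_nonneg (Finset.filter_subset _ _)
          fun t _ _ => Real.sqrt_nonneg _

end IsLorentzianRep

namespace IsLorentzianRep

variable {n : ℕ} {B : Matrix (Fin n) (Fin n) ℝ} {M : CoxeterMatrix (Fin n)}
  {o : Fin n → ℝ} {lam : ℝ} {W : Type*} [Group W] {cs : CoxeterSystem M W}
  {ρ : W →* Module.End ℝ (Fin n → ℝ)}

lemma orbitHeight_pos (H : IsLorentzianRep B o lam cs ρ) (w : W) : 0 < orbitHeight o ρ w :=
  zero_lt_one.trans_le (H.one_le_orbitHeight w)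

/-- Neighbours in the Cayley graph have nearby images, at the scale of the inverse height. -/
lemma exists_dist_mul_simple_le (H : IsLorentzianRep B o lam cs ρ) : ∃ C : ℝ, 0 < C ∧
    ∀ (w : W) (i : Fin n), dist (nrm o (ρ w o)) (nrm o (ρ (w * cs.simple i) o)) ≤
      C * ((orbitHeight o ρ w)⁻¹ + (orbitHeight o ρ (w * cs.simple i))⁻¹) := by
  obtain ⟨μ, hμ, hcoer⟩ := H.coercive
  have hl : 0 < -lam := neg_pos.mpr H.lam_neg
  set D : ℝ := -lam * (1 + 2 * -lam) / μ with hD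
  have hD0 : 0 < D := by positivity
  refine ⟨√D, by positivity, fun w i => ?_⟩
  have hw := H.orbitHeight_pos w
  have hw' := H.orbitHeight_pos (w * cs.simple i)
  have hi : orbitHeight o ρ (cs.simple i) ≤ 1 + 2 * -lam := by
    have h1 := H.orbitHeight_mul_simple 1 i
    have h2 : o i ^ 2 ≤ 1 := by
      rw [← H.sum_sq]
      exact Finset.single_le_sum (f := fun i => o i ^ 2) (fun i _ => sq_nonneg _)
        (Finset.mem_univ i)
    rw [one_mul, H.orbitHeight_one, map_one, Module.End.one_apply] at h1
    rw [h1, show l1 o (Pi.single i 1) = o i by simp [l1, Pi.single_apply]]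
    nlinarith
  set a := (orbitHeight o ρ w)⁻¹ with ha
  set b := (orbitHeight o ρ (w * cs.simple i))⁻¹ with hb
  have ha0 : 0 < a := inv_pos.mpr hw
  have hb0 : 0 < b := inv_pos.mpr hw'
  set d := nrm o (ρ w o) - nrm o (ρ (w * cs.simple i) o) with hd
  have hd0 : l1 o d = 0 := by
    rw [hd, l1_sub, l1_nrm o hw.ne', l1_nrm o hw'.ne', sub_self]
  have hBd : bform B d d ≤ -lam * (1 + 2 * -lam) * (a + b) ^ 2 := by
    have e1 : d = a • ρ w o - b • ρ (w * cs.simple i) o := rfl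
    have e2 : (w * cs.simple i)⁻¹ * w = cs.simple i := by simp
    have e3 : w⁻¹ * (w * cs.simple i) = cs.simple i := by simp
    have e4 : bform B d d =
        lam * (a ^ 2 + b ^ 2) + 2 * (a * b) * (-lam * orbitHeight o ρ (cs.simple i)) := by
      rw [e1]
      simp only [bform_sub_left, bform_sub_right, bform_smul_left, bform_smul_right,
        H.bform_orbit, e2, e3, inv_mul_cancel, H.orbitHeight_one]
      ring
    have e5 : -lam * orbitHeight o ρ (cs.simple i) ≤ -lam * (1 + 2 * -lam) := by gcongr
    have e6 : 2 * (a * b) * (-lam * orbitHeight o ρ (cs.simple i)) ≤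
        2 * (a * b) * (-lam * (1 + 2 * -lam)) := by gcongr
    have e7 : lam * (a ^ 2 + b ^ 2) ≤ 0 :=
      mul_nonpos_of_nonpos_of_nonneg H.lam_neg.le (by positivity)
    have e8 : 0 ≤ -lam * (1 + 2 * -lam) * (a ^ 2 + b ^ 2) := by positivity
    rw [e4]
    linarith
  have hdd : d ⬝ᵥ d ≤ D * (a + b) ^ 2 := by
    have := (hcoer d hd0).trans hBd
    rw [hD, div_mul_eq_mul_div, le_div_iff₀ hμ]
    linarith
  rw [dist_pi_le_iff (by positivity)]
  intro k
  rw [Real.dist_eq]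
  have hk : (d k) ^ 2 ≤ D * (a + b) ^ 2 := by
    refine le_trans ?_ hdd
    rw [pow_two]
    exact Finset.single_le_sum (f := fun i => d i * d i) (fun i _ => mul_self_nonneg _)
      (Finset.mem_univ k)
  refine (Real.abs_le_sqrt hk).trans_eq ?_
  rw [Real.sqrt_mul hD0.le, Real.sqrt_sq (by positivity)]

end IsLorentzianRep

lemma exists_sum_rpow_le {q : ℝ} (hq : 1 < q) : ∃ S : ℝ, 0 < S ∧
    ∀ k a : ℕ, ∑ j ∈ Finset.range k, (1 + |(j : ℝ) - a|) ^ (-q) ≤ S := by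
  have hsum : Summable fun x : ℤ => (1 + |(x : ℝ)|) ^ (-q) := by
    refine Summable.of_norm_bounded_eventually (Real.summable_abs_int_rpow hq) ?_
    filter_upwards [(Set.finite_singleton (0 : ℤ)).compl_mem_cofinite] with x hx
    have hx' : 0 < |(x : ℝ)| := abs_pos.mpr (by exact_mod_cast hx)
    rw [Real.norm_of_nonneg (by positivity)]
    exact Real.rpow_le_rpow_of_nonpos hx' (by linarith) (by linarith)
  refine ⟨1 + ∑' x : ℤ, (1 + |(x : ℝ)|) ^ (-q), ?_, fun k a => ?_⟩
  · have : 0 ≤ ∑' x : ℤ, (1 + |(x : ℝ)|) ^ (-q) := tsum_nonneg fun x => by positivity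
    linarith
  · have hinj : Function.Injective fun j : ℕ => (j : ℤ) - a := fun i j h => by
      simpa using h
    have h1 := hsum.sum_le_tsum ((Finset.range k).map ⟨_, hinj⟩) fun x _ => by positivity
    rw [Finset.sum_map] at h1
    simp only [Function.Embedding.coeFn_mk, Int.cast_sub, Int.cast_natCast] at h1
    linarith

namespace IsLorentzianRep

variable {n : ℕ} {B : Matrix (Fin n) (Fin n) ℝ} {M : CoxeterMatrix (Fin n)}
  {o : Fin n → ℝ} {lam : ℝ} {W : Type*} [Group W] {cs : CoxeterSystem M W}
  {ρ : W →* Module.End ℝ (Fin n → ℝ)}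

/-- Elements with large Gromov product have nearby normalized orbit points. -/
lemma exists_forall_dist_le (H : IsLorentzianRep B o lam cs ρ) (hn : 0 < n) {ε : ℝ}
    (hε : 0 < ε) : ∃ R : ℝ, 0 < R ∧ ∀ x y : W, R ≤ gp cs x y →
      dist (nrm o (ρ x o)) (nrm o (ρ y o)) ≤ ε := by
  obtain ⟨C, hC, hdisp⟩ := H.exists_dist_mul_simple_le
  obtain ⟨c, p, hc, hp, hgrow⟩ := H.exists_rpow_le_orbitHeight hn
  set q : ℝ := (1 + p) / 2 with hq
  have hq1 : 1 < q := by linarith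
  have hpq : 0 < p - q := by linarith
  obtain ⟨S, hS, hsum⟩ := exists_sum_rpow_le hq1
  set A : ℝ := C * (2 * (c⁻¹ * 2 ^ q * S)) with hA
  have hA0 : 0 < A := by positivity
  have hlim : Tendsto (fun R : ℝ => A * R ^ (-(p - q))) atTop (nhds 0) := by
    simpa using (tendsto_rpow_neg_atTop hpq).const_mul A
  obtain ⟨R, hRε, hR1⟩ := ((hlim.eventually_lt_const hε).and (eventually_ge_atTop 1)).exists
  refine ⟨R, by linarith, fun x y hxy => ?_⟩
  obtain ⟨ω, hω, hωxy⟩ := cs.exists_isReduced (x⁻¹ * y)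
  set k := ω.length with hk
  set z : ℕ → W := fun j => x * cs.wordProd (ω.take j) with hz
  have hz0 : z 0 = x := by simp [hz]
  have hzk : z k = y := by simp [hz, hk, ← hωxy]
  have hlen : cs.length (x⁻¹ * y) = k := by rw [hωxy, hω.eq]
  have hgp : 2 * R ≤ cs.length x + cs.length y - k := by
    rw [gp, hlen] at hxy
    linarith
  have htake : ∀ j ≤ k, cs.length (cs.wordProd (ω.take j)) = j := fun j hj => by
    rw [(hω.take j).eq, List.length_take, min_eq_left hj]
  have hzlen : ∀ j ≤ k, R ≤ cs.length (z j) ∧ |(j : ℝ) - cs.length x| ≤ cs.length (z j) := by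
    intro j hj
    have h1 : cs.length x ≤ cs.length (z j) + j := by
      have := cs.length_le_length_mul_add_right x (cs.wordProd (ω.take j))
      rwa [htake j hj] at this
    have h2 : j ≤ cs.length (z j) + cs.length x := by
      have := cs.length_le_length_mul_add_left x (cs.wordProd (ω.take j))
      rwa [htake j hj] at this
    have h3 : cs.length y ≤ cs.length (z j) + (k - j) := by
      have e : y = z j * cs.wordProd (ω.drop j) := by
        rw [hz, mul_assoc, ← cs.wordProd_append, List.take_append_drop, ← hωxy, mul_inv_cancel_left]
      have h4 := cs.length_wordProd_le (ω.drop j)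
      rw [List.length_drop] at h4
      have h5 := cs.length_mul_le (z j) (cs.wordProd (ω.drop j))
      rw [← e] at h5
      omega
    have h1' : (cs.length x : ℝ) ≤ cs.length (z j) + j := by exact_mod_cast h1
    have h2' : (j : ℝ) ≤ cs.length (z j) + cs.length x := by exact_mod_cast h2
    have h3' : (cs.length y : ℝ) + j ≤ cs.length (z j) + k := by
      have : cs.length y + j ≤ cs.length (z j) + k := by omega
      exact_mod_cast this
    exact ⟨by linarith, abs_le.mpr ⟨by linarith, by linarith⟩⟩
  have hinv : ∀ j ≤ k, (orbitHeight o ρ (z j))⁻¹ ≤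
      c⁻¹ * R ^ (-(p - q)) * 2 ^ q * (1 + |(j : ℝ) - cs.length x|) ^ (-q) := by
    intro j hj
    obtain ⟨h1, h2⟩ := hzlen j hj
    set l : ℝ := (cs.length (z j) : ℝ) with hl
    have hl0 : 0 < l := by linarith
    set t : ℝ := 1 + |(j : ℝ) - cs.length x| with ht
    have ht0 : 0 < t := by positivity
    have h3 : t / 2 ≤ l := by linarith
    calc (orbitHeight o ρ (z j))⁻¹ ≤ (c * l ^ p)⁻¹ :=
          inv_anti₀ (by positivity) (hgrow (z j))
      _ = c⁻¹ * (l ^ (-(p - q)) * l ^ (-q)) := by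
          rw [mul_inv, ← Real.rpow_add hl0, ← Real.rpow_neg hl0.le]
          congr 2
          ring
      _ ≤ c⁻¹ * (R ^ (-(p - q)) * (t / 2) ^ (-q)) := by
          gcongr ?_ * (?_ * ?_)
          · exact Real.rpow_le_rpow_of_nonpos (by linarith) h1 (by linarith)
          · exact Real.rpow_le_rpow_of_nonpos (by linarith) h3 (by linarith)
      _ = c⁻¹ * R ^ (-(p - q)) * 2 ^ q * t ^ (-q) := by
          rw [Real.div_rpow ht0.le zero_le_two, Real.rpow_neg zero_le_two q, div_inv_eq_mul]
          ring
  set E : ℝ := c⁻¹ * R ^ (-(p - q)) * 2 ^ q with hE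
  have hE0 : 0 ≤ E := by positivity
  have hsumz : ∑ j ∈ Finset.range (k + 1), (orbitHeight o ρ (z j))⁻¹ ≤ E * S := by
    calc ∑ j ∈ Finset.range (k + 1), (orbitHeight o ρ (z j))⁻¹
        ≤ ∑ j ∈ Finset.range (k + 1), E * (1 + |(j : ℝ) - cs.length x|) ^ (-q) :=
          Finset.sum_le_sum fun j hj => hinv j (Nat.lt_succ_iff.mp (Finset.mem_range.mp hj))
      _ ≤ E * S := by
          rw [← Finset.mul_sum]
          exact mul_le_mul_of_nonneg_left (hsum _ _) hE0
  have hstep : ∀ j < k, dist (nrm o (ρ (z j) o)) (nrm o (ρ (z (j + 1)) o)) ≤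
      C * ((orbitHeight o ρ (z j))⁻¹ + (orbitHeight o ρ (z (j + 1)))⁻¹) := by
    intro j hj
    have e : z (j + 1) = z j * cs.simple ω[j] := by
      simp only [hz]
      rw [mul_assoc, ← cs.wordProd_singleton, ← cs.wordProd_append, List.take_append_getElem]
    rw [e]
    exact hdisp (z j) ω[j]
  calc dist (nrm o (ρ x o)) (nrm o (ρ y o))
      = dist (nrm o (ρ (z 0) o)) (nrm o (ρ (z k) o)) := by rw [hz0, hzk]
    _ ≤ ∑ j ∈ Finset.range k, dist (nrm o (ρ (z j) o)) (nrm o (ρ (z (j + 1)) o)) :=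
        dist_le_range_sum_dist (fun j => nrm o (ρ (z j) o)) k
    _ ≤ ∑ j ∈ Finset.range k,
          C * ((orbitHeight o ρ (z j))⁻¹ + (orbitHeight o ρ (z (j + 1)))⁻¹) :=
        Finset.sum_le_sum fun j hj => hstep j (Finset.mem_range.mp hj)
    _ ≤ C * (E * S + E * S) := by
        rw [← Finset.mul_sum, Finset.sum_add_distrib]
        have hpos : ∀ j, 0 < (orbitHeight o ρ (z j))⁻¹ := fun j =>
          inv_pos.mpr (H.orbitHeight_pos (z j))
        have h1 := hsumz
        have h2 := hsumz
        rw [Finset.sum_range_succ] at h1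
        rw [Finset.sum_range_succ'] at h2
        gcongr
        · linarith [hpos k]
        · linarith [hpos 0]
    _ = A * R ^ (-(p - q)) := by rw [hE, hA]; ring
    _ ≤ ε := hRε.le

end IsLorentzianRep

/-- A Hermitian matrix with one negative and `n - 1` positive eigenvalues is coercive on the
orthogonal complement of an eigenvector with negative eigenvalue. -/
lemma exists_coercive_of_signature {n : ℕ} {B : Matrix (Fin n) (Fin n) ℝ}
    (hherm : B.IsHermitian)
    (hsig_neg : Nat.card {i : Fin n // hherm.eigenvalues i < 0} = 1)
    (hsig_pos : Nat.card {i : Fin n // 0 < hherm.eigenvalues i} = n - 1)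
    {o : Fin n → ℝ} {lam : ℝ} (hlam : lam < 0) (ho : B.mulVec o = lam • o)
    (honorm : ∑ i, (o i) ^ 2 = 1) :
    ∃ μ : ℝ, 0 < μ ∧ ∀ v, l1 o v = 0 → μ * (v ⬝ᵥ v) ≤ bform B v v := by
  classical
  have hsymm : B.IsSymm := by simpa [IsHermitian, IsSymm] using hherm
  obtain ⟨⟨i₀, hi₀⟩⟩ : Nonempty {i : Fin n // hherm.eigenvalues i < 0} :=
    (Nat.card_pos_iff.mp (by omega)).1
  have hn : 0 < n := i₀.pos
  have hpos : ∀ i, i ≠ i₀ → 0 < hherm.eigenvalues i := by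
    rw [Nat.card_eq_fintype_card, Fintype.card_subtype] at hsig_pos
    have h1 := (Finset.univ : Finset (Fin n)).card_filter_add_card_filter_not
      fun i => 0 < hherm.eigenvalues i
    rw [hsig_pos, Finset.card_univ, Fintype.card_fin] at h1
    obtain ⟨a, ha⟩ := Finset.card_eq_one.mp
      (show (Finset.univ.filter fun i => ¬ 0 < hherm.eigenvalues i).card = 1 by omega)
    have h2 : i₀ ∈ Finset.univ.filter fun i => ¬ 0 < hherm.eigenvalues i := by
      simpa using hi₀.le
    rw [ha, Finset.mem_singleton] at h2
    intro i hi
    by_contra hcon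
    have h3 : i ∈ Finset.univ.filter fun i => ¬ 0 < hherm.eigenvalues i := by simpa using hcon
    rw [ha, Finset.mem_singleton] at h3
    exact hi (h3.trans h2.symm)
  set e : Fin n → Fin n → ℝ := fun i => (hherm.eigenvectorBasis i).ofLp with he
  have heig : ∀ i, B.mulVec (e i) = hherm.eigenvalues i • e i := fun i =>
    hherm.mulVec_eigenvectorBasis i
  have hparseval : ∀ u v : Fin n → ℝ, u ⬝ᵥ v = ∑ i, (u ⬝ᵥ e i) * (e i ⬝ᵥ v) := by
    intro u v
    have := hherm.eigenvectorBasis.sum_inner_mul_inner (WithLp.toLp 2 u) (WithLp.toLp 2 v)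
    simp only [EuclideanSpace.inner_eq_star_dotProduct, star_trivial] at this
    rw [dotProduct_comm u v, ← this]
    exact Finset.sum_congr rfl fun i _ => by rw [dotProduct_comm u, dotProduct_comm _ v]
  have hadj : ∀ i v, e i ⬝ᵥ B.mulVec v = hherm.eigenvalues i * (e i ⬝ᵥ v) := by
    intro i v
    have := bform_comm hsymm (e i) v
    rw [bform, bform, heig, dotProduct_smul, smul_eq_mul] at this
    rw [this, dotProduct_comm]
  have hoe : ∀ i, i ≠ i₀ → e i ⬝ᵥ o = 0 := by
    intro i hi
    have h1 := hadj i o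
    rw [ho, dotProduct_smul, smul_eq_mul] at h1
    have h2 : (lam - hherm.eigenvalues i) * (e i ⬝ᵥ o) = 0 := by linarith
    rcases mul_eq_zero.mp h2 with h | h
    · linarith [hpos i hi]
    · exact h
  have hsingle : ∀ v : Fin n → ℝ, v ⬝ᵥ o = (v ⬝ᵥ e i₀) * (e i₀ ⬝ᵥ o) := fun v => by
    rw [hparseval v o]
    exact Finset.sum_eq_single _ (fun i _ hi => by rw [hoe i hi, mul_zero]) (by simp)
  have hne : e i₀ ⬝ᵥ o ≠ 0 := by
    intro h0
    have h1 := hsingle o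
    rw [h0, mul_zero] at h1
    have h2 : o ⬝ᵥ o = 1 := by
      rw [← honorm]
      exact Finset.sum_congr rfl fun i _ => (pow_two _).symm
    linarith
  have : Nonempty (Fin n) := ⟨i₀⟩
  obtain ⟨j, hj⟩ := Finite.exists_min fun i => if i = i₀ then 1 else hherm.eigenvalues i
  refine ⟨if j = i₀ then 1 else hherm.eigenvalues j, ?_, fun v hv => ?_⟩
  · split_ifs with h
    · exact one_pos
    · exact hpos j h
  · have hv0 : v ⬝ᵥ e i₀ = 0 := by
      have h1 := hsingle v
      rw [dotProduct_comm v o, show o ⬝ᵥ v = 0 from hv] at h1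
      exact (mul_eq_zero.mp h1.symm).resolve_right hne
    rw [bform, hparseval v v, hparseval v (B.mulVec v), Finset.mul_sum]
    refine Finset.sum_le_sum fun i _ => ?_
    rw [hadj, dotProduct_comm (e i) v]
    by_cases hi : i = i₀
    · rw [hi, hv0]
      simp
    · have := hj i
      simp only [if_neg hi] at this
      nlinarith [mul_self_nonneg (v ⬝ᵥ e i)]

section GromovSequences

variable {I : Type*} {M : CoxeterMatrix I} {W : Type*} [Group W] (cs : CoxeterSystem M W)

lemma le_gp_of_take_eq {ω ω' : List I} (hω : cs.IsReduced ω) (hω' : cs.IsReduced ω') {k : ℕ}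
    (hk : k ≤ ω.length) (hk' : k ≤ ω'.length) (h : ω.take k = ω'.take k) :
    (k : ℝ) ≤ gp cs (cs.wordProd ω) (cs.wordProd ω') := by
  have e : (cs.wordProd ω)⁻¹ * cs.wordProd ω' =
      (cs.wordProd (ω.drop k))⁻¹ * cs.wordProd (ω'.drop k) := by
    conv_lhs => rw [← List.take_append_drop k ω, ← List.take_append_drop k ω', ← h]
    rw [cs.wordProd_append, cs.wordProd_append]
    group
  have h1 := cs.length_mul_le (cs.wordProd (ω.drop k))⁻¹ (cs.wordProd (ω'.drop k))
  rw [cs.length_inv, (hω.drop k).eq, (hω'.drop k).eq, List.length_drop, List.length_drop] at h1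
  have h2 : (cs.length ((cs.wordProd ω)⁻¹ * cs.wordProd ω') : ℝ) + 2 * k ≤
      ω.length + ω'.length := by
    rw [e]
    have : cs.length ((cs.wordProd (ω.drop k))⁻¹ * cs.wordProd (ω'.drop k)) + 2 * k ≤
      ω.length + ω'.length := by omega
    exact_mod_cast this
  rw [gp, hω.eq, hω'.eq]
  linarith

lemma tendsto_length_cofinite [Finite I] : Tendsto cs.length cofinite atTop := by
  refine tendsto_atTop.mpr fun k => ?_
  have hfin : {w : W | cs.length w ≤ k}.Finite := by
    refine ((List.finite_length_le I k).image cs.wordProd).subset fun w hw => ?_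
    obtain ⟨ω, hω, rfl⟩ := cs.exists_isReduced w
    exact ⟨ω, by simpa [hω.eq] using hw, rfl⟩
  filter_upwards [hfin.compl_mem_cofinite] with w hw
  exact (not_le.mp (show ¬ cs.length w ≤ k from hw)).le

/-- Every injective sequence in a finitely generated Coxeter group has a Gromov subsequence. -/
lemma exists_isGromovSeq_comp [Finite I] {f : ℕ → W} (hf : Function.Injective f) :
    ∃ φ : ℕ → ℕ, StrictMono φ ∧ IsGromovSeq cs (f ∘ φ) := by
  choose ω hω hωf using fun j => cs.exists_isReduced (f j)
  let _ : TopologicalSpace (Option I) := ⊥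
  have : DiscreteTopology (Option I) := ⟨rfl⟩
  obtain ⟨a, φ, hφ, hlim⟩ := CompactSpace.tendsto_subseq fun (j k : ℕ) => (ω j)[k]?
  refine ⟨φ, hφ, ?_⟩
  have hlen : Tendsto (fun j => cs.length (f (φ j))) atTop atTop :=
    (tendsto_length_cofinite cs).comp
      ((Nat.cofinite_eq_atTop ▸ hf.tendsto_cofinite).comp hφ.tendsto_atTop)
  rw [tendsto_pi_nhds] at hlim
  refine tendsto_atTop.mpr fun b => ?_
  set K := ⌈b⌉₊ with hK
  have hev : ∀ᶠ j in atTop, (∀ k ∈ Finset.range K, (ω (φ j))[k]? = a k) ∧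
      K ≤ cs.length (f (φ j)) := by
    refine ((Finset.range K).eventually_all.mpr fun k _ => ?_).and (hlen.eventually_ge_atTop K)
    simpa [nhds_discrete, tendsto_pure] using hlim k
  rw [← prod_atTop_atTop_eq]
  filter_upwards [hev.prod_mk hev] with ⟨i, j⟩ ⟨⟨hi, hil⟩, ⟨hj, hjl⟩⟩
  refine (Nat.le_ceil b).trans ?_
  simp only [Function.comp_apply]
  rw [hωf (φ i), (hω _).eq] at hil
  rw [hωf (φ j), (hω _).eq] at hjl
  rw [hωf (φ i), hωf (φ j)]
  refine le_gp_of_take_eq cs (hω _) (hω _) hil hjl (List.ext_getElem? fun k => ?_)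
  rw [List.getElem?_take, List.getElem?_take]
  split_ifs with hk
  · rw [hi k (Finset.mem_range.mpr hk), hj k (Finset.mem_range.mpr hk)]
  · rfl

variable {cs} in
lemma IsGromovSeq.tendsto_length {x : ℕ → W} (hx : IsGromovSeq cs x) :
    Tendsto (fun i => cs.length (x i)) atTop atTop := by
  have h1 : Tendsto (fun i : ℕ => (i, i)) atTop (atTop : Filter (ℕ × ℕ)) := by
    rw [← prod_atTop_atTop_eq]
    exact tendsto_id.prodMk tendsto_id
  have h2 := hx.comp h1
  simp only [Function.comp_def, gp, inv_mul_cancel, cs.length_one, Nat.cast_zero, sub_zero,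
    add_self_div_two] at h2
  exact tendsto_natCast_atTop_iff.mp h2

lemma eventually_lt_gp_of_lt_egp {a b : GBdry cs} (hab : a ≠ b) {R : ℝ} {x y : GromovSeq cs}
    (hx : Quot.mk (gromovRel cs) x = a) (hy : Quot.mk (gromovRel cs) y = b)
    (h : ENNReal.ofReal R < egp cs a b) :
    ∀ᶠ p : ℕ × ℕ in atTop, R < gp cs (x.1 p.1) (y.1 p.2) := by
  rw [egp, if_neg hab] at h
  have h1 := h.trans_le (iInf₂_le_of_le x hx (iInf₂_le_of_le y hy le_rfl))
  filter_upwards [eventually_lt_of_lt_liminf h1] with p hp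
  exact (ENNReal.ofReal_lt_ofReal_iff'.mp hp).1

end GromovSequences

namespace IsLorentzianRep

variable {n : ℕ} {B : Matrix (Fin n) (Fin n) ℝ} {M : CoxeterMatrix (Fin n)}
  {o : Fin n → ℝ} {lam : ℝ} {W : Type*} [Group W] {cs : CoxeterSystem M W}
  {ρ : W →* Module.End ℝ (Fin n → ℝ)}

lemma exists_tendsto_of_isGromovSeq (H : IsLorentzianRep B o lam cs ρ) (hn : 0 < n)
    (x : GromovSeq cs) : ∃ ξ, Tendsto (fun i => nrm o (ρ (x.1 i) o)) atTop (nhds ξ) := by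
  refine cauchySeq_tendsto_of_complete (Metric.cauchySeq_iff.mpr fun ε hε => ?_)
  obtain ⟨R, -, hR⟩ := H.exists_forall_dist_le hn (half_pos hε)
  obtain ⟨N, hN⟩ := eventually_atTop.mp (x.2.eventually_ge_atTop R)
  refine ⟨max N.1 N.2, fun i hi j hj => (hR _ _ (hN (i, j) ⟨?_, ?_⟩)).trans_lt (half_lt_self hε)⟩
  · exact (le_max_left _ _).trans hi
  · exact (le_max_right _ _).trans hj

lemma dist_le_of_eventually_le_gp {R ε : ℝ}
    (hR : ∀ x y : W, R ≤ gp cs x y → dist (nrm o (ρ x o)) (nrm o (ρ y o)) ≤ ε)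
    {x y : GromovSeq cs} {ξ η : Fin n → ℝ}
    (hξ : Tendsto (fun i => nrm o (ρ (x.1 i) o)) atTop (nhds ξ))
    (hη : Tendsto (fun i => nrm o (ρ (y.1 i) o)) atTop (nhds η))
    (h : ∀ᶠ p : ℕ × ℕ in atTop, R ≤ gp cs (x.1 p.1) (y.1 p.2)) : dist ξ η ≤ ε := by
  rw [← prod_atTop_atTop_eq] at h
  exact le_of_tendsto ((hξ.comp tendsto_fst).dist (hη.comp tendsto_snd))
    (h.mono fun p hp => hR _ _ hp)

/-- Equivariance of limits of normalized orbit points. -/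
lemma tendsto_nrm_rho_mul (H : IsLorentzianRep B o lam cs ρ) (w : W) {x : ℕ → W}
    {ξ : Fin n → ℝ} (hξ : Tendsto (fun i => nrm o (ρ (x i) o)) atTop (nhds ξ)) :
    Tendsto (fun i => nrm o (ρ (w * x i) o)) atTop (nhds (nrm o (ρ w ξ))) := by
  have hl1 : l1 o ξ = 1 := by
    refine tendsto_nhds_unique (((continuous_l1 o).tendsto ξ).comp hξ) ?_
    simp only [Function.comp_def, fun i => l1_nrm o (H.orbitHeight_pos (x i)).ne',
      tendsto_const_nhds]
  have hB : bform B ξ ξ ≤ 0 := by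
    refine le_of_tendsto (((continuous_bform_self B).tendsto ξ).comp hξ) (.of_forall fun i => ?_)
    simp only [Function.comp_apply, nrm, bform_smul_left, bform_smul_right, H.bform_orbit,
      inv_mul_cancel, H.orbitHeight_one, mul_one, ← mul_assoc]
    exact mul_nonpos_of_nonneg_of_nonpos (mul_self_nonneg _) H.lam_neg.le
  have hne : l1 o (ρ w ξ) ≠ 0 := by
    intro h0
    obtain ⟨μ, hμ, hcoer⟩ := H.coercive
    have h1 := hcoer _ h0
    rw [H.bform_rho] at h1
    have h2 : ρ w ξ ⬝ᵥ ρ w ξ = 0 := by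
      have h3 : 0 ≤ ρ w ξ ⬝ᵥ ρ w ξ := Finset.sum_nonneg fun i _ => mul_self_nonneg _
      nlinarith
    have h4 : ρ w⁻¹ (ρ w ξ) = ξ := by
      rw [← Module.End.mul_apply, ← map_mul, inv_mul_cancel, map_one, Module.End.one_apply]
    rw [dotProduct_self_eq_zero.mp h2, map_zero] at h4
    rw [← h4, l1_zero] at hl1
    exact zero_ne_one hl1
  have hcont : Tendsto (ρ w) (nhds ξ) (nhds (ρ w ξ)) :=
    (ρ w).continuous_of_finiteDimensional.tendsto ξ
  refine (((continuousAt_nrm o hne).tendsto.comp hcont).comp hξ).congr fun i => ?_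
  simp only [Function.comp_apply]
  rw [show nrm o (ρ (x i) o) = (orbitHeight o ρ (x i))⁻¹ • ρ (x i) o from rfl, map_smul,
    nrm_smul o (inv_pos.mpr (H.orbitHeight_pos (x i))).ne', map_mul, Module.End.mul_apply]

end IsLorentzianRep

theorem cannon_thurston_map_exists
    (n : ℕ) (B : Matrix (Fin n) (Fin n) ℝ) (M : CoxeterMatrix (Fin n))
    (hherm : B.IsHermitian)
    (hdiag : ∀ i, B i i = 1)
    (hfin : ∀ i j, M i j ≠ 0 → B i j = -Real.cos (Real.pi / (M i j : ℝ)))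
    (hinf : ∀ i j, M i j = 0 → B i j ≤ -1)
    (hsig_neg : Nat.card {i : Fin n // hherm.eigenvalues i < 0} = 1)
    (hsig_pos : Nat.card {i : Fin n // 0 < hherm.eigenvalues i} = n - 1)
    (o : Fin n → ℝ) (lam : ℝ) (hlam : lam < 0) (ho : B.mulVec o = lam • o)
    (hopos : ∀ i, 0 < o i) (honorm : ∑ i, (o i) ^ 2 = 1)
    (W : Type*) [Group W] (cs : CoxeterSystem M W)
    (ρ : W →* Module.End ℝ (Fin n → ℝ))
    (hρ : ∀ (i : Fin n) (v : Fin n → ℝ),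
      ρ (cs.simple i) v = v - (2 * bform B (Pi.single i 1) v) • (Pi.single i 1 : Fin n → ℝ)) :
    ∃ F : GBdry cs → (Fin n → ℝ),
      @Continuous _ _ (bdryTop cs) _ F ∧
      Set.range F = limitSet o ρ ∧
      (∀ (w : W) (x y : GromovSeq cs), (∀ i, y.1 i = w * x.1 i) →
        F (Quot.mk (gromovRel cs) y) = nrm o (ρ w (F (Quot.mk (gromovRel cs) x)))) := by
  have hn : 0 < n := by
    rcases Nat.eq_zero_or_pos n with rfl | hn
    · simp at honorm
    · exact hn
  have H : IsLorentzianRep B o lam cs ρ :=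
    { isSymm := by simpa [IsHermitian, IsSymm] using hherm
      diag := hdiag
      of_ne_zero := hfin
      of_eq_zero := hinf
      lam_neg := hlam
      eigen := ho
      pos := hopos
      sum_sq := honorm
      simple_apply := hρ
      coercive := exists_coercive_of_signature hherm hsig_neg hsig_pos hlam ho honorm }
  choose G hG using H.exists_tendsto_of_isGromovSeq hn
  have hrel : ∀ x y : GromovSeq cs, gromovRel cs x y → G x = G y := by
    refine fun x y hxy => eq_of_forall_dist_le fun ε hε => ?_
    obtain ⟨R, -, hR⟩ := H.exists_forall_dist_le hn hε
    exact IsLorentzianRep.dist_le_of_eventually_le_gp hR (hG x) (hG y) (hxy.eventually_ge_atTop R)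
  refine ⟨Quot.lift G hrel, ?_, Set.Subset.antisymm ?_ ?_, ?_⟩
  · let _ := bdryTop cs
    refine continuous_iff_continuousAt.mpr fun a => Metric.tendsto_nhds.mpr fun ε hε => ?_
    obtain ⟨R, hR0, hR⟩ := H.exists_forall_dist_le hn (half_pos hε)
    have hopen : IsOpen {b | ENNReal.ofReal R < egp cs a b} :=
      TopologicalSpace.GenerateOpen.basic _ ⟨a, R, hR0, rfl⟩
    have hmem : a ∈ {b | ENNReal.ofReal R < egp cs a b} := by simp [egp]
    filter_upwards [hopen.mem_nhds hmem] with b hb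
    by_cases hab : a = b
    · rw [hab, dist_self]
      exact hε
    obtain ⟨x, hx⟩ := Quot.exists_rep a
    obtain ⟨y, hy⟩ := Quot.exists_rep b
    have hev := (eventually_lt_gp_of_lt_egp cs hab hx hy hb).mono fun _ h => h.le
    rw [dist_comm, ← hx, ← hy]
    exact (IsLorentzianRep.dist_le_of_eventually_le_gp hR (hG x) (hG y) hev).trans_lt
      (half_lt_self hε)
  · rintro _ ⟨a, rfl⟩
    obtain ⟨x, rfl⟩ := Quot.exists_rep a
    obtain ⟨φ, hφ, hφx⟩ := strictMono_subseq_of_tendsto_atTop x.2.tendsto_length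
    refine ⟨x.1 ∘ φ, ?_, (hG x).comp hφ.tendsto_atTop⟩
    exact Function.Injective.of_comp (f := cs.length) hφx.injective
  · rintro ξ ⟨f, hf, hlim⟩
    obtain ⟨φ, hφ, hgrom⟩ := exists_isGromovSeq_comp cs hf
    exact ⟨Quot.mk _ ⟨f ∘ φ, hgrom⟩,
      tendsto_nhds_unique (hG ⟨f ∘ φ, hgrom⟩) (hlim.comp hφ.tendsto_atTop)⟩
  · intro w x y hxy
    refine tendsto_nhds_unique (hG y) ?_
    simp only [hxy]
    exact H.tendsto_nrm_rho_mul w (hG x)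

end
end
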